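/- The 7-dimensional nilpotent Lie algebra 𝔤 = (0,0,0,12,13−24,23+14,0) admits no cocalibrated G2-structure: there is no closed 4-form φ on 𝔤 that is the dual (Hodge star) of a positive 3-form. -/

import Mathlib

/- STATEMENT 16: The 7-dimensional nilpotent Lie algebra 𝔤 = (0,0,0,12,13−24,23+14,0)
admits no cocalibrated G2-structure: no closed 4-form on 𝔤 is the Hodge dual of a
positive 3-form; equivalently, no closed 4-form lies in the GL(7,ℝ)-orbit of the
standard positive 4-form Φ₀ = f¹²³⁴+f¹²⁵⁶+f³⁴⁵⁶+f²⁴⁶⁷−f¹³⁶⁷−f¹⁴⁵⁷−f²³⁵⁷.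
(0-based indices below.) -/

noncomputable section

open ExteriorAlgebra

abbrev W7 : Type := Fin 7 → ℝ

def ev (i : Fin 7) : ExteriorAlgebra ℝ W7 := ExteriorAlgebra.ι ℝ (Pi.single i 1)

/-- the differentials of 𝔤 = (0,0,0,12,13−24,23+14,0) -/
def d1 : Fin 7 → ExteriorAlgebra ℝ W7 :=
  ![0, 0, 0, ev 0 * ev 1, ev 0 * ev 2 - ev 1 * ev 3, ev 1 * ev 2 + ev 0 * ev 3, 0]

def phi4 (c : Fin 7 → Fin 7 → Fin 7 → Fin 7 → ℝ) : ExteriorAlgebra ℝ W7 :=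
  ∑ i : Fin 7, ∑ j : Fin 7, ∑ k : Fin 7, ∑ l : Fin 7,
    if i < j ∧ j < k ∧ k < l then c i j k l • (ev i * ev j * ev k * ev l) else 0

def dPhi4 (c : Fin 7 → Fin 7 → Fin 7 → Fin 7 → ℝ) : ExteriorAlgebra ℝ W7 :=
  ∑ i : Fin 7, ∑ j : Fin 7, ∑ k : Fin 7, ∑ l : Fin 7,
    if i < j ∧ j < k ∧ k < l then
      c i j k l • (d1 i * ev j * ev k * ev l - ev i * d1 j * ev k * ev l
        + ev i * ev j * d1 k * ev l - ev i * ev j * ev k * d1 l)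
    else 0

/-- the standard positive (G2) 4-form (0-based indices) -/
def Phi0 : ExteriorAlgebra ℝ W7 :=
  ev 0 * ev 1 * ev 2 * ev 3 + ev 0 * ev 1 * ev 4 * ev 5 + ev 2 * ev 3 * ev 4 * ev 5
    + ev 1 * ev 3 * ev 5 * ev 6 - ev 0 * ev 2 * ev 5 * ev 6
    - ev 0 * ev 3 * ev 4 * ev 6 - ev 1 * ev 2 * ev 4 * ev 6

set_option linter.unusedSimpArgs false

theorem ev_sq (i : Fin 7) : ev i * ev i = 0 := ExteriorAlgebra.ι_sq_zero _

theorem ev_sq_assoc (i : Fin 7) (x : ExteriorAlgebra ℝ W7) : ev i * (ev i * x) = 0 := by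
  rw [← mul_assoc, ev_sq, zero_mul]

theorem ev_swap {i j : Fin 7} (_h : i < j) : ev j * ev i = -(ev i * ev j) :=
  eq_neg_of_add_eq_zero_left (ExteriorAlgebra.ι_add_mul_swap _ _)

theorem ev_swap_assoc {i j : Fin 7} (h : i < j) (x : ExteriorAlgebra ℝ W7) :
    ev j * (ev i * x) = -(ev i * (ev j * x)) := by
  rw [← mul_assoc, ev_swap h, neg_mul, mul_assoc]

def top7 : ExteriorAlgebra ℝ W7 := ev 0 * (ev 1 * (ev 2 * (ev 3 * (ev 4 * (ev 5 * ev 6)))))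

/-- The determinant functional shows that the volume form is nonzero. -/
theorem top7_ne : top7 ≠ 0 := by
  intro h
  have h1 : top7 = ExteriorAlgebra.ιMulti ℝ 7 (fun i : Fin 7 => (Pi.single i 1 : W7)) := by
    simp [top7, ev, ExteriorAlgebra.ιMulti_apply, List.ofFn_succ]
    rfl
  let f : ∀ i : ℕ, W7 [⋀^Fin i]→ₗ[ℝ] ℝ :=
    Pi.single 7 (Matrix.detRowAlternating (n := Fin 7) (R := ℝ))
  have h2 := ExteriorAlgebra.liftAlternating_apply_ιMulti (R := ℝ) f
    (fun i : Fin 7 => (Pi.single i 1 : W7))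
  rw [← h1, h, map_zero] at h2
  have h3 : f 7 = Matrix.detRowAlternating (n := Fin 7) (R := ℝ) := Pi.single_eq_same _ _
  rw [h3] at h2
  have h4 : (fun i : Fin 7 => (Pi.single i 1 : W7)) = (1 : Matrix (Fin 7) (Fin 7) ℝ) := by
    ext i j
    simp [Matrix.one_apply, Pi.single_apply, eq_comm]
  have h5 : Matrix.det (fun i : Fin 7 => (Pi.single i 1 : W7)) = 1 :=
    (congrArg Matrix.det h4).trans Matrix.det_one
  exact zero_ne_one (h2.trans h5)

theorem smul_top {r : ℝ} (h : r • top7 = 0) : r = 0 :=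
  (smul_eq_zero.mp h).resolve_right top7_ne

theorem ι_expand (u : W7) : ExteriorAlgebra.ι ℝ u = u 0 • ev 0 + u 1 • ev 1 + u 2 • ev 2
    + u 3 • ev 3 + u 4 • ev 4 + u 5 • ev 5 + u 6 • ev 6 := by
  conv_lhs => rw [pi_eq_sum_univ' u]
  simp only [map_add, map_smul, Fin.sum_univ_seven]
  rfl

set_option maxHeartbeats 4000000 in
theorem sum_quads (F : Fin 7 → Fin 7 → Fin 7 → Fin 7 → ExteriorAlgebra ℝ W7) :
    (∑ i : Fin 7, ∑ j : Fin 7, ∑ k : Fin 7, ∑ l : Fin 7,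
      if i < j ∧ j < k ∧ k < l then F i j k l else 0) =
    F 0 1 2 3 + F 0 1 2 4 + F 0 1 2 5 + F 0 1 2 6 + F 0 1 3 4
      + F 0 1 3 5 + F 0 1 3 6 + F 0 1 4 5 + F 0 1 4 6 + F 0 1 5 6
      + F 0 2 3 4 + F 0 2 3 5 + F 0 2 3 6 + F 0 2 4 5 + F 0 2 4 6
      + F 0 2 5 6 + F 0 3 4 5 + F 0 3 4 6 + F 0 3 5 6 + F 0 4 5 6
      + F 1 2 3 4 + F 1 2 3 5 + F 1 2 3 6 + F 1 2 4 5 + F 1 2 4 6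
      + F 1 2 5 6 + F 1 3 4 5 + F 1 3 4 6 + F 1 3 5 6 + F 1 4 5 6
      + F 2 3 4 5 + F 2 3 4 6 + F 2 3 5 6 + F 2 4 5 6 + F 3 4 5 6 := by
  simp only [ite_and, Fin.sum_univ_seven, Fin.reduceLT, if_true, if_false, add_zero, zero_add,
    Fin.isValue, lt_self_iff_false]
  abel

set_option maxHeartbeats 8000000 in
theorem coefs (c : Fin 7 → Fin 7 → Fin 7 → Fin 7 → ℝ) (h : dPhi4 c = 0) :
    c 2 3 4 5 = 0 ∧ c 2 3 5 6 = 0 ∧ c 2 3 4 6 = 0 ∧ c 3 4 5 6 = 0 ∧ c 2 4 5 6 = 0 := by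
  have hm : ∀ x, dPhi4 c * x = 0 := fun x => by rw [h, zero_mul]
  rw [dPhi4, sum_quads] at hm
  have h0 := hm (ev 3 * ev 6)
  have h1 := hm (ev 3 * ev 4 + ev 2 * ev 5)
  have h2 := hm (ev 3 * ev 5 - ev 2 * ev 4)
  have h3 := hm (ev 2 * ev 3)
  have h4 := hm (ev 1 * ev 5)
  simp only [d1, Matrix.cons_val, mul_assoc, ev_sq, ev_sq_assoc, ev_swap, ev_swap_assoc, mul_add, add_mul,
    mul_sub, sub_mul, mul_neg, neg_mul, smul_mul_assoc, mul_smul_comm, mul_zero, zero_mul,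
    smul_zero, neg_zero, neg_neg, smul_neg, smul_add, smul_sub, add_zero, zero_add, sub_zero,
    zero_sub, sub_neg_eq_add, Fin.reduceLT, Fin.isValue, sub_self] at h0 h1 h2 h3 h4
  refine ⟨smul_top ?_, smul_top ?_, smul_top ?_, smul_top ?_, smul_top ?_⟩ <;> rw [top7]
  · linear_combination (norm := module) (-1 : ℝ) • h0
  · linear_combination (norm := module) (-1 : ℝ) • h1
  · linear_combination (norm := module) (1 : ℝ) • h2
  · linear_combination (norm := module) (1 : ℝ) • h3
  · linear_combination (norm := module) (1 : ℝ) • h4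

set_option maxHeartbeats 4000000 in
theorem wedge_zero (c : Fin 7 → Fin 7 → Fin 7 → Fin 7 → ℝ) (h : dPhi4 c = 0) :
    ev 0 * ev 1 * phi4 c = 0 := by
  obtain ⟨h0, h1, h2, h3, h4⟩ := coefs c h
  rw [phi4, sum_quads]
  simp only [h0, h1, h2, h3, h4, zero_smul, mul_assoc, ev_sq, ev_sq_assoc, ev_swap, ev_swap_assoc, mul_add, add_mul,
    mul_sub, sub_mul, mul_neg, neg_mul, smul_mul_assoc, mul_smul_comm, mul_zero, zero_mul,
    smul_zero, neg_zero, neg_neg, smul_neg, smul_add, smul_sub, add_zero, zero_add, sub_zero,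
    zero_sub, sub_neg_eq_add, Fin.reduceLT, Fin.isValue, sub_self]

set_option maxHeartbeats 8000000 in
theorem cross (u v : W7) (h : ExteriorAlgebra.ι ℝ u * ExteriorAlgebra.ι ℝ v * Phi0 = 0) :
    (1) * (u 1 * v 6 - u 6 * v 1) + (-1) * (u 2 * v 4 - u 4 * v 2) + (1) * (u 3 * v 5 - u 5 * v 3) = 0 ∧
    (-1) * (u 0 * v 6 - u 6 * v 0) + (1) * (u 3 * v 4 - u 4 * v 3) + (1) * (u 2 * v 5 - u 5 * v 2) = 0 ∧
    (1) * (u 3 * v 6 - u 6 * v 3) + (1) * (u 0 * v 4 - u 4 * v 0) + (-1) * (u 1 * v 5 - u 5 * v 1) = 0 ∧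
    (-1) * (u 2 * v 6 - u 6 * v 2) + (-1) * (u 1 * v 4 - u 4 * v 1) + (-1) * (u 0 * v 5 - u 5 * v 0) = 0 ∧
    (1) * (u 5 * v 6 - u 6 * v 5) + (-1) * (u 0 * v 2 - u 2 * v 0) + (1) * (u 1 * v 3 - u 3 * v 1) = 0 ∧
    (-1) * (u 4 * v 6 - u 6 * v 4) + (1) * (u 1 * v 2 - u 2 * v 1) + (1) * (u 0 * v 3 - u 3 * v 0) = 0 ∧
    (1) * (u 4 * v 5 - u 5 * v 4) + (1) * (u 2 * v 3 - u 3 * v 2) + (1) * (u 0 * v 1 - u 1 * v 0) = 0 := by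
  have hm : ∀ x, ExteriorAlgebra.ι ℝ u * (ExteriorAlgebra.ι ℝ v * (Phi0 * x)) = 0 := fun x => by
    rw [← mul_assoc, ← mul_assoc, h, zero_mul]
  rw [Phi0, ι_expand v] at hm
  have h0 := hm (ev 0)
  have h1 := hm (ev 1)
  have h2 := hm (ev 2)
  have h3 := hm (ev 3)
  have h4 := hm (ev 4)
  have h5 := hm (ev 5)
  have h6 := hm (ev 6)
  simp only [mul_assoc, ev_sq, ev_sq_assoc, ev_swap, ev_swap_assoc, mul_add, add_mul,
    mul_sub, sub_mul, mul_neg, neg_mul, smul_mul_assoc, mul_smul_comm, mul_zero, zero_mul,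
    smul_zero, neg_zero, neg_neg, smul_neg, smul_add, smul_sub, add_zero, zero_add, sub_zero,
    zero_sub, sub_neg_eq_add, Fin.reduceLT, Fin.isValue, sub_self] at h0 h1 h2 h3 h4 h5 h6
  rw [ι_expand u] at h0 h1 h2 h3 h4 h5 h6
  simp only [mul_assoc, ev_sq, ev_sq_assoc, ev_swap, ev_swap_assoc, mul_add, add_mul,
    mul_sub, sub_mul, mul_neg, neg_mul, smul_mul_assoc, mul_smul_comm, mul_zero, zero_mul,
    smul_zero, neg_zero, neg_neg, smul_neg, smul_add, smul_sub, add_zero, zero_add, sub_zero,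
    zero_sub, sub_neg_eq_add, Fin.reduceLT, Fin.isValue, sub_self] at h0 h1 h2 h3 h4 h5 h6
  refine ⟨smul_top ?_, smul_top ?_, smul_top ?_, smul_top ?_, smul_top ?_, smul_top ?_, smul_top ?_⟩ <;> rw [top7]
  · linear_combination (norm := module) (1 : ℝ) • h0
  · linear_combination (norm := module) (1 : ℝ) • h1
  · linear_combination (norm := module) (1 : ℝ) • h2
  · linear_combination (norm := module) (1 : ℝ) • h3
  · linear_combination (norm := module) (1 : ℝ) • h4
  · linear_combination (norm := module) (1 : ℝ) • h5
  · linear_combination (norm := module) (1 : ℝ) • h6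

theorem gram (u v : W7) (h : ExteriorAlgebra.ι ℝ u * ExteriorAlgebra.ι ℝ v * Phi0 = 0)
    (i j : Fin 7) : u i * v j - u j * v i = 0 := by
  obtain ⟨c0, c1, c2, c3, c4, c5, c6⟩ := cross u v h
  have key : (∑ a : Fin 7, ∑ b : Fin 7, (u a * v b - u b * v a) ^ 2) = 0 := by
    have e : (∑ a : Fin 7, ∑ b : Fin 7, (u a * v b - u b * v a) ^ 2) =
      2 * (((1) * (u 1 * v 6 - u 6 * v 1) + (-1) * (u 2 * v 4 - u 4 * v 2) + (1) * (u 3 * v 5 - u 5 * v 3)) ^ 2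
      + ((-1) * (u 0 * v 6 - u 6 * v 0) + (1) * (u 3 * v 4 - u 4 * v 3) + (1) * (u 2 * v 5 - u 5 * v 2)) ^ 2
      + ((1) * (u 3 * v 6 - u 6 * v 3) + (1) * (u 0 * v 4 - u 4 * v 0) + (-1) * (u 1 * v 5 - u 5 * v 1)) ^ 2
      + ((-1) * (u 2 * v 6 - u 6 * v 2) + (-1) * (u 1 * v 4 - u 4 * v 1) + (-1) * (u 0 * v 5 - u 5 * v 0)) ^ 2
      + ((1) * (u 5 * v 6 - u 6 * v 5) + (-1) * (u 0 * v 2 - u 2 * v 0) + (1) * (u 1 * v 3 - u 3 * v 1)) ^ 2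
      + ((-1) * (u 4 * v 6 - u 6 * v 4) + (1) * (u 1 * v 2 - u 2 * v 1) + (1) * (u 0 * v 3 - u 3 * v 0)) ^ 2
      + ((1) * (u 4 * v 5 - u 5 * v 4) + (1) * (u 2 * v 3 - u 3 * v 2) + (1) * (u 0 * v 1 - u 1 * v 0)) ^ 2) := by
      simp only [Fin.sum_univ_seven]
      ring
    rw [e, c0, c1, c2, c3, c4, c5, c6]
    norm_num
  have k1 := (Finset.sum_eq_zero_iff_of_nonneg
    (fun a _ => Finset.sum_nonneg (fun b _ => sq_nonneg (u a * v b - u b * v a)))).mp key i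
    (Finset.mem_univ _)
  have k2 := (Finset.sum_eq_zero_iff_of_nonneg
    (fun b _ => sq_nonneg (u i * v b - u b * v i))).mp k1 j (Finset.mem_univ _)
  exact pow_eq_zero_iff (two_ne_zero) |>.mp k2

theorem no_cocalibrated_G2_structure' :
    ¬ ∃ c : Fin 7 → Fin 7 → Fin 7 → Fin 7 → ℝ,
        dPhi4 c = 0 ∧
        ∃ g : W7 ≃ₗ[ℝ] W7, phi4 c = ExteriorAlgebra.map (g : W7 →ₗ[ℝ] W7) Phi0 := by
  rintro ⟨c, hd, g, hg⟩
  have h0 := wedge_zero c hd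
  rw [hg] at h0
  have h1 := congrArg (ExteriorAlgebra.map (g.symm : W7 →ₗ[ℝ] W7)) h0
  have h2 : ExteriorAlgebra.map (g.symm : W7 →ₗ[ℝ] W7)
      (ExteriorAlgebra.map (g : W7 →ₗ[ℝ] W7) Phi0) = Phi0 := by
    rw [← AlgHom.comp_apply, ExteriorAlgebra.map_comp_map]
    simp
  rw [map_mul, map_mul, map_zero, h2, ev, ev, ExteriorAlgebra.map_apply_ι,
    ExteriorAlgebra.map_apply_ι] at h1
  set u : W7 := (g.symm : W7 →ₗ[ℝ] W7) (Pi.single 0 1) with hu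
  set v : W7 := (g.symm : W7 →ₗ[ℝ] W7) (Pi.single 1 1) with hv
  have hs : ∀ i j, u i * v j - u j * v i = 0 := gram u v h1
  have hu0 : u ≠ 0 := by
    intro h
    have h3 := congrArg g h
    simp [hu] at h3
  obtain ⟨j, hj⟩ : ∃ j, u j ≠ 0 := by
    by_contra hcon
    push Not at hcon
    exact hu0 (funext hcon)
  have h4 : u j • v = v j • u := by
    funext i
    simp only [Pi.smul_apply, smul_eq_mul]
    linarith [hs j i]
  have hgu : g u = Pi.single 0 1 := by simp [hu]
  have hgv : g v = Pi.single 1 1 := by simp [hv]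
  have h5 := congrArg g h4
  rw [map_smul, map_smul, hgu, hgv] at h5
  have h6 := congrFun h5 1
  simp [Pi.single_apply] at h6
  exact hj h6

end
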